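/- Let G be a countably infinite discrete group and (X,G) a G-system on a compact metric space. A point x ∈ X is distal if and only if for every piecewise syndetic recurrent point y in any G-system (Y,G), the pair (x,y) is recurrent in the product system (X×Y,G). -/

import Mathlib

/-- A subset `A` of a group `G` is thick if for every nonempty finite `K ⊆ G`
there exists `g ∈ G` with `Kg ⊆ A`. -/
def Thick {G : Type*} [Group G] (A : Set G) : Prop :=
  ∀ K : Finset G, K.Nonempty → ∃ g : G, ∀ k ∈ K, k * g ∈ A

/-- A subset `A` of a group `G` is syndetic if there is a finite `K ⊆ G` with `G = K⁻¹A`. -/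
def Syndetic {G : Type*} [Group G] (A : Set G) : Prop :=
  ∃ K : Finset G, ∀ g : G, ∃ k ∈ K, k * g ∈ A

/-- `A` is piecewise syndetic if it is the intersection of a thick set and a syndetic set. -/
def PiecewiseSyndetic {G : Type*} [Group G] (A : Set G) : Prop :=
  ∃ B C : Set G, Thick B ∧ Syndetic C ∧ A = B ∩ C

/-- A `G`-system: a continuous action of `G` on a compact metric space. -/
structure GSystem (G : Type*) [Group G] where
  X : Type
  [ms : MetricSpace X]
  [cs : CompactSpace X]
  act : G → X → X
  act_one : ∀ x, act 1 x = x
  act_mul : ∀ g h x, act (g * h) x = act g (act h x)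
  act_cont : ∀ g, Continuous (act g)

attribute [instance] GSystem.ms GSystem.cs

variable {G : Type*} [Group G]

/-- `(x₁, x₂)` is a proximal pair: `inf_g d(gx₁, gx₂) = 0`. -/
def IsProximalPair (S : GSystem G) (x₁ x₂ : S.X) : Prop :=
  ∀ ε > (0 : ℝ), ∃ g : G, dist (S.act g x₁) (S.act g x₂) < ε

/-- `x` is a distal point: it is proximal to no point of its orbit closure other than itself. -/
def IsDistalPoint (S : GSystem G) (x : S.X) : Prop :=
  ∀ y ∈ closure (Set.range fun g : G => S.act g x), y ≠ x → ¬ IsProximalPair S x y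

/-- A point `y` is piecewise syndetic recurrent if all its return time sets are
piecewise syndetic. -/
def IsPsRecurrentPoint (S : GSystem G) (y : S.X) : Prop :=
  ∀ V ∈ nhds y, PiecewiseSyndetic {g : G | S.act g y ∈ V}

open Filter Topology
open scoped Pointwise

attribute [local instance] Ultrafilter.mul Ultrafilter.semigroup

/-- A set is piecewise syndetic iff finitely many of its left translates cover a thick set. -/
theorem piecewiseSyndetic_iff {A : Set G} :
    PiecewiseSyndetic A ↔
      ∃ K : Finset G, ∀ F : Finset G, ∃ g, ∀ f ∈ F, ∃ k ∈ K, k * (f * g) ∈ A := by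
  classical
  constructor
  · rintro ⟨B, C, hB, ⟨K, hK⟩, rfl⟩
    refine ⟨K, fun F => ?_⟩
    obtain ⟨k₀, hk₀, -⟩ := hK 1
    rcases F.eq_empty_or_nonempty with rfl | hF
    · exact ⟨1, by simp⟩
    obtain ⟨g, hg⟩ := hB (K * F) (Finset.Nonempty.mul ⟨k₀, hk₀⟩ hF)
    refine ⟨g, fun f hf => ?_⟩
    obtain ⟨k, hk, hkC⟩ := hK (f * g)
    exact ⟨k, hk, by simpa [mul_assoc] using hg _ (Finset.mul_mem_mul hk hf), hkC⟩
  · rintro ⟨K, hK⟩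
    set T : Set G := {g | ∃ k ∈ K, k * g ∈ A} with hT
    refine ⟨A ∪ T, A ∪ Tᶜ, ?_, ⟨insert 1 K, fun g => ?_⟩, ?_⟩
    · intro F _
      obtain ⟨g, hg⟩ := hK F
      exact ⟨g, fun f hf => Or.inr (hg f hf)⟩
    · by_cases hg : g ∈ T
      · obtain ⟨k, hk, hkA⟩ := hg
        exact ⟨k, Finset.mem_insert_of_mem hk, Or.inl hkA⟩
      · exact ⟨1, Finset.mem_insert_self _ _, Or.inr (by simpa using hg)⟩
    · rw [← Set.union_inter_distrib_left, Set.inter_compl_self, Set.union_empty]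

theorem PiecewiseSyndetic.mono {A B : Set G} (hA : PiecewiseSyndetic A) (h : A ⊆ B) :
    PiecewiseSyndetic B := by
  rw [piecewiseSyndetic_iff] at *
  obtain ⟨K, hK⟩ := hA
  refine ⟨K, fun F => ?_⟩
  obtain ⟨g, hg⟩ := hK F
  refine ⟨g, fun f hf => ?_⟩
  obtain ⟨k, hk, hkA⟩ := hg f hf
  exact ⟨k, hk, h hkA⟩

theorem piecewiseSyndetic_univ : PiecewiseSyndetic (Set.univ : Set G) :=
  piecewiseSyndetic_iff.2 ⟨{1}, fun _ => ⟨1, by simp⟩⟩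

theorem not_piecewiseSyndetic_empty : ¬ PiecewiseSyndetic (∅ : Set G) := by
  rw [piecewiseSyndetic_iff]
  rintro ⟨K, hK⟩
  obtain ⟨g, hg⟩ := hK {1}
  simpa using hg 1

theorem PiecewiseSyndetic.of_preimage_mul_left {A : Set G} (h : G)
    (hA : PiecewiseSyndetic {g | h * g ∈ A}) : PiecewiseSyndetic A := by
  classical
  rw [piecewiseSyndetic_iff] at *
  obtain ⟨K, hK⟩ := hA
  refine ⟨K.image (h * ·), fun F => ?_⟩
  obtain ⟨g, hg⟩ := hK F
  refine ⟨g, fun f hf => ?_⟩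
  obtain ⟨k, hk, hkA⟩ := hg f hf
  exact ⟨h * k, Finset.mem_image_of_mem _ hk, by simpa [mul_assoc] using hkA⟩

/-- Piecewise syndeticity is partition regular. -/
theorem PiecewiseSyndetic.of_union {A B : Set G} (h : PiecewiseSyndetic (A ∪ B)) :
    PiecewiseSyndetic A ∨ PiecewiseSyndetic B := by
  classical
  rw [piecewiseSyndetic_iff] at h
  obtain ⟨K, hK⟩ := h
  by_contra! hAB
  obtain ⟨hA, hB⟩ := hAB
  simp only [piecewiseSyndetic_iff] at hA hB
  push Not at hA hB
  obtain ⟨F, hF⟩ := hA K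
  obtain ⟨H, hH⟩ := hB (K * F)
  obtain ⟨g, hg⟩ := hK (F * H)
  obtain ⟨h, hh, hhB⟩ := hH g
  obtain ⟨f, hf, hfA⟩ := hF (h * g)
  obtain ⟨k, hk, hkAB⟩ := hg (f * h) (Finset.mul_mem_mul hf hh)
  rcases hkAB with hkA | hkB
  · exact hfA k hk (by simpa [mul_assoc] using hkA)
  · exact hhB (k * f) (Finset.mul_mem_mul hk hf) (by simpa [mul_assoc] using hkB)

theorem exists_translate_avoiding [Infinite G] {A : Set G} {K : Finset G}
    (hK : ∀ F : Finset G, ∃ g, ∀ f ∈ F, ∃ k ∈ K, k * (f * g) ∈ A) (F D : Finset G) :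
    ∃ g, ∀ f ∈ F, (∃ k ∈ K, k * (f * g) ∈ A) ∧ f * g ∉ D := by
  classical
  obtain ⟨C, hC⟩ := Infinite.exists_subset_card_eq G ((F⁻¹ * D).card + 1)
  obtain ⟨g, hg⟩ := hK (F * C)
  have : ∃ c ∈ C, c * g ∉ F⁻¹ * D := by
    by_contra! hc
    have h1 : C.image (· * g) ⊆ F⁻¹ * D := by
      intro a ha
      obtain ⟨c, hcC, rfl⟩ := Finset.mem_image.1 ha
      exact hc c hcC
    have h2 := Finset.card_le_card h1
    rw [Finset.card_image_of_injective _ (mul_left_injective g)] at h2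
    omega
  obtain ⟨c, hc, hcD⟩ := this
  refine ⟨c * g, fun f hf => ⟨?_, fun hD => hcD ?_⟩⟩
  · simpa [mul_assoc] using hg (f * c) (Finset.mul_mem_mul hf hc)
  · simpa using Finset.mul_mem_mul (Finset.inv_mem_inv hf) hD

theorem PiecewiseSyndetic.infinite [Infinite G] {A : Set G} (hA : PiecewiseSyndetic A) :
    A.Infinite := by
  classical
  intro hfin
  obtain ⟨K, hK⟩ := piecewiseSyndetic_iff.1 hA
  obtain ⟨g, hg⟩ := exists_translate_avoiding hK {1} (K⁻¹ * hfin.toFinset)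
  obtain ⟨⟨k, hk, hkA⟩, hgD⟩ := hg 1 (by simp)
  refine hgD ?_
  simpa using Finset.mul_mem_mul (Finset.inv_mem_inv hk) (hfin.mem_toFinset.2 hkA)

/-- The ultrafilters all of whose members are piecewise syndetic. -/
def psUltrafilters (G : Type*) [Group G] : Set (Ultrafilter G) :=
  {p | ∀ A ∈ p, PiecewiseSyndetic A}

theorem isClosed_psUltrafilters : IsClosed (psUltrafilters G) := by
  have : psUltrafilters G = ⋂ A ∈ {A : Set G | ¬ PiecewiseSyndetic A},
      {p : Ultrafilter G | Aᶜ ∈ p} := by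
    ext p
    simp only [psUltrafilters, Set.mem_ofPred_eq, Set.mem_iInter, Ultrafilter.compl_mem_iff_notMem]
    exact forall_congr' fun A => ⟨fun h h' h'' => h' (h h''), fun h h' => by
      by_contra h''; exact h h'' h'⟩
  rw [this]
  exact isClosed_biInter fun A _ => ultrafilter_isClosed_basic _

theorem mul_mem_psUltrafilters_left (p : Ultrafilter G) {q : Ultrafilter G}
    (hq : q ∈ psUltrafilters G) : p * q ∈ psUltrafilters G := by
  intro A hA
  have h := (Ultrafilter.eventually_mul p q (· ∈ A)).1 hA
  obtain ⟨g, hg⟩ := h.exists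
  exact .of_preimage_mul_left g (hq _ hg)

theorem mul_mem_psUltrafilters_right {p : Ultrafilter G} (q : Ultrafilter G)
    (hp : p ∈ psUltrafilters G) : p * q ∈ psUltrafilters G := by
  intro A hA
  have h := (Ultrafilter.eventually_mul p q (· ∈ A)).1 hA
  obtain ⟨K, hK⟩ := piecewiseSyndetic_iff.1 (hp _ h)
  refine piecewiseSyndetic_iff.2 ⟨K, fun F => ?_⟩
  obtain ⟨g, hg⟩ := hK F
  choose! k hk hkA using hg
  have : ∀ᶠ h in (q : Filter G), ∀ f ∈ F, k f * (f * g) * h ∈ A :=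
    (Finset.eventually_all F).2 hkA
  obtain ⟨h, hh⟩ := this.exists
  exact ⟨g * h, fun f hf => ⟨k f, hk f hf, by simpa [mul_assoc] using hh f hf⟩⟩

theorem exists_mem_psUltrafilters_le {F : Filter G} (hF : ∀ A ∈ F, PiecewiseSyndetic A) :
    ∃ p ∈ psUltrafilters G, (p : Filter G) ≤ F := by
  let N : Filter G :=
    { sets := {A | ¬ PiecewiseSyndetic Aᶜ}
      univ_sets := by simpa using not_piecewiseSyndetic_empty
      sets_of_superset := fun {A B} hA h hB => hA (hB.mono (Set.compl_subset_compl.2 h))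
      inter_sets := fun {A B} hA hB h => by
        rw [Set.compl_inter] at h
        exact h.of_union.elim hA hB }
  have hN : ∀ A, A ∈ N ↔ ¬ PiecewiseSyndetic Aᶜ := fun A => Iff.rfl
  have hne : (F ⊓ N).NeBot := by
    rw [inf_neBot_iff]
    intro A hA B hB
    by_contra h
    refine (hN B).1 hB ((hF A hA).mono fun a ha hb => h ⟨a, ha, hb⟩)
  refine ⟨Ultrafilter.of (F ⊓ N), fun A hA => ?_, (Ultrafilter.of_le _).trans inf_le_left⟩
  by_contra h
  have : Aᶜ ∈ N := by rw [hN, compl_compl]; exact h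
  exact Ultrafilter.compl_notMem_iff.2 hA ((Ultrafilter.of_le _).trans inf_le_right this)

theorem isClosed_setOf_tendsto {α X : Type*} [TopologicalSpace X] (u : α → X) (z : X) :
    IsClosed {q : Ultrafilter α | Tendsto u q (𝓝 z)} := by
  have : {q : Ultrafilter α | Tendsto u q (𝓝 z)} =
      ⋂ V ∈ 𝓝 z, {q : Ultrafilter α | u ⁻¹' V ∈ q} := by
    ext q
    simp [Tendsto, Filter.le_def]
  rw [this]
  exact isClosed_biInter fun V _ => ultrafilter_isClosed_basic _

theorem exists_tendsto_ultrafilter {α X : Type*} [TopologicalSpace X] [CompactSpace X]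
    (u : α → X) (q : Ultrafilter α) : ∃ z, Tendsto u q (𝓝 z) :=
  ⟨(q.map u).lim, (q.map u).le_nhds_lim⟩

theorem GSystem.tendsto_mul (S : GSystem G) {p q : Ultrafilter G} {x z w : S.X}
    (hq : Tendsto (S.act · x) q (𝓝 z)) (hp : Tendsto (S.act · z) p (𝓝 w)) :
    Tendsto (S.act · x) (p * q : Ultrafilter G) (𝓝 w) := by
  rw [(nhds_basis_opens w).tendsto_right_iff]
  rintro O ⟨hw, hO⟩
  refine (Ultrafilter.eventually_mul p q (fun g => S.act g x ∈ O)).2 ?_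
  filter_upwards [hp (hO.mem_nhds hw)] with g hg
  have := hq (((hO.preimage (S.act_cont g)).mem_nhds hg))
  filter_upwards [this] with h hh
  rw [S.act_mul]
  exact hh

theorem exists_idempotent_of_isClosed {s : Set (Ultrafilter G)} (hne : s.Nonempty)
    (hs : IsClosed s) (hmul : ∀ p ∈ s, ∀ q ∈ s, p * q ∈ s) : ∃ p ∈ s, p * p = p :=
  exists_idempotent_in_compact_subsemigroup Ultrafilter.continuous_mul_left s hne hs.isCompact
    fun p hp q hq => hmul p hp q hq

/-- Idempotents fix distal points. -/
theorem IsDistalPoint.tendsto_of_idempotent {S : GSystem G} {x : S.X} (hx : IsDistalPoint S x)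
    {p : Ultrafilter G} (hp : p * p = p) : Tendsto (S.act · x) p (𝓝 x) := by
  obtain ⟨z, hz⟩ := exists_tendsto_ultrafilter (S.act · x) p
  obtain ⟨w, hw⟩ := exists_tendsto_ultrafilter (S.act · z) p
  have hwz : w = z := by
    have := S.tendsto_mul hz hw
    rw [hp] at this
    exact tendsto_nhds_unique this hz
  subst hwz
  by_cases h : w = x
  · rwa [h] at hz
  refine absurd ?_ (hx w (mem_closure_of_tendsto hz (.of_forall fun g => ⟨g, rfl⟩)) h)
  intro ε hε
  have := hz.dist hw
  rw [dist_self] at this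
  exact (this.eventually (gt_mem_nhds hε)).exists

theorem IsDistalPoint.recurrent_pair [Infinite G] {S : GSystem G} {x : S.X}
    (hx : IsDistalPoint S x) {T : GSystem G} {y : T.X} (hy : IsPsRecurrentPoint T y)
    {W : Set (S.X × T.X)} (hW : W ∈ 𝓝 (x, y)) :
    {g : G | (S.act g x, T.act g y) ∈ W}.Infinite := by
  have hF : ∀ A ∈ comap (T.act · y) (𝓝 y), PiecewiseSyndetic A := by
    rintro A ⟨V, hV, hVA⟩
    exact (hy V hV).mono hVA
  obtain ⟨q, hq, hqy⟩ := exists_mem_psUltrafilters_le hF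
  obtain ⟨p, ⟨hp, hpy⟩, hpp⟩ := exists_idempotent_of_isClosed
    (s := psUltrafilters G ∩ {q | Tendsto (T.act · y) q (𝓝 y)})
    ⟨q, hq, tendsto_iff_comap.2 hqy⟩
    (isClosed_psUltrafilters.inter (isClosed_setOf_tendsto _ _))
    fun p hp q hq => ⟨mul_mem_psUltrafilters_left p hq.1, T.tendsto_mul hq.2 hp.2⟩
  exact (hp _ (((hx.tendsto_of_idempotent hpp).prodMk_nhds hpy) hW)).infinite

theorem mul_mem_setOf_asymptotic (S : GSystem G) {x z : S.X} (p : Ultrafilter G)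
    {q : Ultrafilter G} (hq : Tendsto (fun g => dist (S.act g x) (S.act g z)) q (𝓝 0)) :
    Tendsto (fun g => dist (S.act g x) (S.act g z)) (p * q : Ultrafilter G) (𝓝 0) := by
  obtain ⟨a, ha⟩ := exists_tendsto_ultrafilter (S.act · x) q
  obtain ⟨b, hb⟩ := exists_tendsto_ultrafilter (S.act · z) q
  have hab : a = b := dist_eq_zero.1 (tendsto_nhds_unique (ha.dist hb) hq)
  subst hab
  obtain ⟨c, hc⟩ := exists_tendsto_ultrafilter (S.act · a) p
  simpa using (S.tendsto_mul ha hc).dist (S.tendsto_mul hb hc)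

/-- A non-distal point is moved by some idempotent with piecewise syndetic members. -/
theorem exists_idempotent_of_not_isDistalPoint {S : GSystem G} {x : S.X}
    (hx : ¬ IsDistalPoint S x) :
    ∃ p ∈ psUltrafilters G, p * p = p ∧ ∃ z ≠ x, Tendsto (S.act · x) p (𝓝 z) := by
  unfold IsDistalPoint at hx
  push Not at hx
  obtain ⟨z, hzx, hne, hprox⟩ := hx
  by_contra! hcon
  have hfix : ∀ p ∈ psUltrafilters G, p * p = p → Tendsto (S.act · x) p (𝓝 x) := by
    intro p hp hpp
    obtain ⟨w, hw⟩ := exists_tendsto_ultrafilter (S.act · x) p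
    by_cases h : w = x
    · rwa [h] at hw
    · exact absurd hw (hcon p hp hpp w h)
  set D : Set (Ultrafilter G) :=
    {q | Tendsto (fun g => dist (S.act g x) (S.act g z)) q (𝓝 0)} with hD
  have hDne : D.Nonempty := by
    have : (comap (fun g => dist (S.act g x) (S.act g z)) (𝓝 0)).NeBot := by
      rw [comap_neBot_iff]
      intro t ht
      obtain ⟨ε, hε, hεt⟩ := Metric.mem_nhds_iff.1 ht
      obtain ⟨g, hg⟩ := hprox ε hε
      exact ⟨g, hεt (by simpa [abs_of_nonneg dist_nonneg] using hg)⟩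
    exact ⟨Ultrafilter.of _, tendsto_iff_comap.2 (Ultrafilter.of_le _)⟩
  obtain ⟨d, hd⟩ := hDne
  obtain ⟨i, hi, -⟩ := exists_mem_psUltrafilters_le (F := (⊤ : Filter G))
    (fun A hA => by rw [mem_top.1 hA]; exact piecewiseSyndetic_univ)
  have hJ : IsClosed (psUltrafilters G ∩ D) :=
    isClosed_psUltrafilters.inter (isClosed_setOf_tendsto _ _)
  have hJmul : ∀ p, ∀ q ∈ psUltrafilters G ∩ D, p * q ∈ psUltrafilters G ∩ D := fun p q hq =>
    ⟨mul_mem_psUltrafilters_left p hq.1, mul_mem_setOf_asymptotic S p hq.2⟩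
  obtain ⟨p, hpJ, hpp⟩ := exists_idempotent_of_isClosed (s := psUltrafilters G ∩ D)
    ⟨i * d, mul_mem_psUltrafilters_right d hi, mul_mem_setOf_asymptotic S i hd⟩ hJ
    fun p _ q hq => hJmul p q hq
  have hasymp : ∀ q ∈ D, ∀ w, Tendsto (S.act · z) q (𝓝 w) → Tendsto (S.act · x) q (𝓝 w) := by
    intro q hq w hw
    rw [tendsto_iff_dist_tendsto_zero] at hw ⊢
    refine squeeze_zero (fun _ => dist_nonneg) (fun g => dist_triangle _ (S.act g z) _) ?_
    simpa using Tendsto.add hq hw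
  have hpz : Tendsto (S.act · z) p (𝓝 x) := by
    obtain ⟨w, hw⟩ := exists_tendsto_ultrafilter (S.act · z) p
    rwa [tendsto_nhds_unique (hasymp p hpJ.2 w hw) (hfix p hpJ.1 hpp)] at hw
  obtain ⟨r, hr⟩ : ∃ r : Ultrafilter G, Tendsto (S.act · x) r (𝓝 z) := by
    have : (comap (fun g : G => S.act g x) (𝓝 z)).NeBot := by
      rw [comap_neBot_iff]
      intro t ht
      obtain ⟨_, hgt, g, rfl⟩ := mem_closure_iff_nhds.1 hzx t ht
      exact ⟨g, hgt⟩
    exact ⟨Ultrafilter.of _, tendsto_iff_comap.2 (Ultrafilter.of_le _)⟩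
  obtain ⟨v, ⟨hvJ, hvz⟩, hvv⟩ := exists_idempotent_of_isClosed
    (s := (psUltrafilters G ∩ D) ∩ {q | Tendsto (S.act · z) q (𝓝 z)})
    ⟨r * p, hJmul r p hpJ, S.tendsto_mul hpz hr⟩ (hJ.inter (isClosed_setOf_tendsto _ _))
    fun p hp q hq => ⟨hJmul p q hq.1, S.tendsto_mul hq.2 hp.2⟩
  exact hne (tendsto_nhds_unique (hasymp v hvJ.2 z hvz) (hfix v hvJ.1 hvv))

/-- Members of an idempotent ultrafilter contain a member `R` all of whose translates by elements
of `R` are again in the ultrafilter. -/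
theorem exists_subset_forall_translate_mem {p : Ultrafilter G} (hp : p * p = p) {A : Set G}
    (hA : A ∈ p) : ∃ R ⊆ A, R ∈ p ∧ ∀ r ∈ R, {g | r * g ∈ R} ∈ p := by
  have key : ∀ B ∈ p, {r | {g | r * g ∈ B} ∈ p} ∈ p := fun B hB =>
    (Ultrafilter.eventually_mul p p (· ∈ B)).1 (by rw [hp]; exact hB)
  refine ⟨A ∩ {r | {g | r * g ∈ A} ∈ p}, Set.inter_subset_left,
    Filter.inter_mem hA (key A hA), ?_⟩
  rintro r ⟨-, hr⟩
  filter_upwards [hr, key _ hr] with g hg hg'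
  refine ⟨hg, ?_⟩
  simpa [mul_assoc] using hg'

theorem exists_maximal_separated (F E₀ : Finset G) (hF : F.Nonempty) :
    ∃ E ⊆ E₀, (∀ e ∈ E, ∀ e' ∈ E, ∀ f ∈ F, ∀ f' ∈ F, f * e = f' * e' → e = e') ∧
      ∀ q ∈ E₀, ∃ e ∈ E, ∃ f ∈ F, ∃ f' ∈ F, f * e = f' * q := by
  classical
  obtain ⟨E, hE⟩ := (E₀.powerset.filter fun E : Finset G =>
    ∀ e ∈ E, ∀ e' ∈ E, ∀ f ∈ F, ∀ f' ∈ F, f * e = f' * e' → e = e').exists_maximal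
      ⟨∅, by simp⟩
  obtain ⟨hE₀, hsep⟩ := Finset.mem_filter.1 hE.prop
  rw [Finset.mem_powerset] at hE₀
  refine ⟨E, hE₀, hsep, fun q hq => ?_⟩
  by_contra! hcon
  have hins : insert q E ≤ E := by
    refine hE.le_of_ge (Finset.mem_filter.2 ⟨?_, ?_⟩) (Finset.subset_insert _ _)
    · exact Finset.mem_powerset.2 (Finset.insert_subset hq hE₀)
    · intro e he e' he' f hf f' hf' h
      rcases Finset.mem_insert.1 he with he | he <;>
        rcases Finset.mem_insert.1 he' with he' | he'
      · rw [he, he']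
      · exact absurd (he ▸ h.symm) (hcon e' he' f' hf' f hf)
      · exact absurd (he' ▸ h) (hcon e he f hf f' hf')
      · exact hsep e he e' he' f hf f' hf' h
  obtain ⟨f, hf⟩ := hF
  exact hcon q (hins (Finset.mem_insert_self _ _)) f hf f hf rfl

theorem exists_separated_copies [Infinite G] {p : Ultrafilter G} (hp : p ∈ psUltrafilters G)
    {R : Set G} (hRp : R ∈ p) (hR : ∀ r ∈ R, {g | r * g ∈ R} ∈ p) (F a : Finset G)
    (hF : F.Nonempty) (ha : ∀ s ∈ a, s = 1 ∨ s ∈ R) :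
    ∃ K : Finset G, ∀ M H : Finset G, ∃ E : Finset G,
      (∀ e ∈ E, ∀ s ∈ a, s * e ∈ R) ∧ (∀ e ∈ E, ∀ f ∈ F, f * e ∉ M) ∧
      (∀ e ∈ E, ∀ e' ∈ E, ∀ f ∈ F, ∀ f' ∈ F, f * e = f' * e' → e = e') ∧
      ∃ g, ∀ h ∈ H, ∃ k ∈ K, k * (h * g) ∈ E := by
  classical
  have hQ : {g | ∀ s ∈ a, s * g ∈ R} ∈ p := by
    refine (Finset.eventually_all a).2 fun s hs => ?_
    rcases ha s hs with rfl | hs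
    · simpa using hRp
    · exact hR s hs
  obtain ⟨K, hK⟩ := piecewiseSyndetic_iff.1 (hp _ hQ)
  refine ⟨F⁻¹ * F * K, fun M H => ?_⟩
  obtain ⟨g, hg⟩ := exists_translate_avoiding hK H (K⁻¹ * (F⁻¹ * M))
  obtain ⟨E, hE, hsep, hmax⟩ := exists_maximal_separated F
    ((K * H).image (· * g) |>.filter fun e => ∀ s ∈ a, s * e ∈ R) hF
  refine ⟨E, fun e he => (Finset.mem_filter.1 (hE he)).2, ?_, hsep, g, fun h hh => ?_⟩
  · intro e he f hf hM
    obtain ⟨c, hc, rfl⟩ := Finset.mem_image.1 (Finset.mem_filter.1 (hE he)).1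
    obtain ⟨k, hk, h, hh, rfl⟩ := Finset.mem_mul.1 hc
    refine (hg h hh).2 ?_
    have := Finset.mul_mem_mul (Finset.inv_mem_inv hk)
      (Finset.mul_mem_mul (Finset.inv_mem_inv hf) hM)
    simpa [mul_assoc] using this
  · obtain ⟨k, hk, hkQ⟩ := (hg h hh).1
    obtain ⟨e, he, f, hf, f', hf', hfe⟩ := hmax (k * (h * g)) (Finset.mem_filter.2
      ⟨Finset.mem_image.2 ⟨k * h, Finset.mul_mem_mul hk hh, mul_assoc _ _ _⟩, hkQ⟩)
    refine ⟨f⁻¹ * f' * k, Finset.mul_mem_mul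
      (Finset.mul_mem_mul (Finset.inv_mem_inv hf) hf') hk, ?_⟩
    have : f⁻¹ * f' * k * (h * g) = e := by
      rw [mul_assoc, mul_assoc, ← hfe, inv_mul_cancel_left]
    rwa [this]

/-- Inside `R ∪ {1}` there is a set containing `1` each of whose finite patterns recurs along a
piecewise syndetic set. -/
theorem exists_ps_recurrent_set [Countable G] [Infinite G] {p : Ultrafilter G}
    (hp : p ∈ psUltrafilters G) {R : Set G} (hRp : R ∈ p)
    (hR : ∀ r ∈ R, {g | r * g ∈ R} ∈ p) :
    ∃ Y : Set G, 1 ∈ Y ∧ (∀ g ∈ Y, g = 1 ∨ g ∈ R) ∧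
      ∀ F : Finset G, PiecewiseSyndetic {g | ∀ f ∈ F, f * g ∈ Y ↔ f ∈ Y} := by
  classical
  let Y : (G → Bool) → Set G := fun w => {g | g = 1 ∨ g ∈ R ∧ w g = true}
  have hYcl : ∀ g, IsClopen {w | g ∈ Y w} := by
    intro g
    have : {w | g ∈ Y w} = (fun w : G → Bool => w g) ⁻¹' {b | g = 1 ∨ g ∈ R ∧ b = true} := rfl
    rw [this]
    exact (isClopen_discrete _).preimage (continuous_apply g)
  have hiff : ∀ (g : G) (c : Prop), IsClopen {w | g ∈ Y w ↔ c} := by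
    intro g c
    by_cases hc : c
    · simpa [hc] using hYcl g
    · simp only [hc, iff_false]
      exact (hYcl g).compl
  have hKex : ∀ F a : Finset G, ∃ K : Finset G, F.Nonempty → (∀ s ∈ a, s = 1 ∨ s ∈ R) →
      ∀ M H : Finset G, ∃ E : Finset G,
      (∀ e ∈ E, ∀ s ∈ a, s * e ∈ R) ∧ (∀ e ∈ E, ∀ f ∈ F, f * e ∉ M) ∧
      (∀ e ∈ E, ∀ e' ∈ E, ∀ f ∈ F, ∀ f' ∈ F, f * e = f' * e' → e = e') ∧
      ∃ g, ∀ h ∈ H, ∃ k ∈ K, k * (h * g) ∈ E := by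
    intro F a
    by_cases h : F.Nonempty ∧ (∀ s ∈ a, s = 1 ∨ s ∈ R)
    · obtain ⟨K, hK⟩ := exists_separated_copies hp hRp hR F a h.1 h.2
      exact ⟨K, fun _ _ => hK⟩
    · exact ⟨∅, fun h1 h2 => absurd ⟨h1, h2⟩ h⟩
  choose K hK using hKex
  let O : Finset G × Finset G × Finset G → Set (G → Bool) := fun i =>
    {w | (∀ f ∈ i.1, f ∈ Y w ↔ f ∈ i.2.1) → ∃ g, ∀ h ∈ i.2.2, ∃ k ∈ K i.1 i.2.1,
      ∀ f ∈ i.1, f * (k * (h * g)) ∈ Y w ↔ f ∈ i.2.1}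
  have hOopen : ∀ i, IsOpen (O i) := by
    rintro ⟨F, a, H⟩
    have : O (F, a, H) = (⋂ f ∈ F, {w | f ∈ Y w ↔ f ∈ a})ᶜ ∪ ⋃ g, ⋂ h ∈ H, ⋃ k ∈ K F a,
        ⋂ f ∈ F, {w | f * (k * (h * g)) ∈ Y w ↔ f ∈ a} := by
      ext w
      simp only [O, Set.mem_union, Set.mem_compl_iff, Set.mem_iInter, Set.mem_iUnion,
        Set.mem_ofPred_eq, exists_prop, imp_iff_not_or]
    rw [this]
    refine IsOpen.union ?_ (isOpen_iUnion fun g => isOpen_biInter_finset fun h _ =>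
      isOpen_biUnion fun k _ => isOpen_biInter_finset fun f _ => (hiff _ _).isOpen)
    exact (isClosed_biInter fun f _ => (hiff _ _).isClosed).isOpen_compl
  have hOdense : ∀ i, i.1.Nonempty → i.2.1 ⊆ i.1 → Dense (O i) := by
    rintro ⟨F, a, H⟩ hF haF
    rw [dense_iff_inter_open]
    rintro U hU ⟨w₀, hw₀⟩
    by_cases hpat : ∀ f ∈ F, f ∈ Y w₀ ↔ f ∈ a
    swap
    · exact ⟨w₀, hw₀, fun h => absurd h hpat⟩
    obtain ⟨I, u, hIu, hIU⟩ := isOpen_pi_iff.1 hU w₀ hw₀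
    have ha : ∀ s ∈ a, s = 1 ∨ s ∈ R := fun s hs =>
      ((hpat s (haF hs)).2 hs).imp_right And.left
    obtain ⟨E, hER, hEM, hsep, g, hg⟩ := hK F a hF ha (insert 1 I) H
    let w : G → Bool := fun c =>
      if c ∈ insert 1 I then w₀ c else decide (∃ s ∈ a, ∃ e ∈ E, c = s * e)
    have hwY : ∀ c ∉ insert 1 I, c ∈ Y w ↔ ∃ s ∈ a, ∃ e ∈ E, c = s * e := by
      intro c hc
      have hc1 : c ≠ 1 := fun h => hc (h ▸ Finset.mem_insert_self _ _)
      constructor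
      · rintro (h | ⟨-, h⟩)
        · exact absurd h hc1
        · simpa only [w, if_neg hc, decide_eq_true_eq] using h
      · rintro h
        refine Or.inr ⟨?_, ?_⟩
        · obtain ⟨s, hs, e, he, rfl⟩ := h
          exact hER e he s hs
        · simpa only [w, if_neg hc, decide_eq_true_eq] using h
    refine ⟨w, hIU fun c hc => ?_, fun _ => ⟨g, fun h hh => ?_⟩⟩
    · have : w c = w₀ c := if_pos (Finset.mem_insert_of_mem hc)
      rw [this]
      exact (hIu c hc).2
    · obtain ⟨k, hk, hkE⟩ := hg h hh
      refine ⟨k, hk, fun f hf => ?_⟩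
      rw [hwY _ (hEM _ hkE f hf)]
      constructor
      · rintro ⟨s, hs, e, he, hfe⟩
        have := hsep _ hkE e he f hf s (haF hs) hfe
        rw [← this] at hfe
        rwa [mul_right_cancel hfe]
      · exact fun hfa => ⟨f, hfa, _, hkE, rfl⟩
  let ι := {i : Finset G × Finset G × Finset G // i.1.Nonempty ∧ i.2.1 ⊆ i.1}
  obtain ⟨w, hw⟩ := (dense_iInter_of_isOpen (f := fun i : ι => O i) (fun i => hOopen i)
    fun i => hOdense i i.2.1 i.2.2).nonempty
  refine ⟨Y w, Or.inl rfl, fun g hg => hg.imp_right And.left, fun F => ?_⟩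
  have hmain : ∀ F : Finset G, F.Nonempty →
      PiecewiseSyndetic {g | ∀ f ∈ F, f * g ∈ Y w ↔ f ∈ Y w} := by
    intro F hF
    refine piecewiseSyndetic_iff.2 ⟨K F (F.filter (· ∈ Y w)), fun H => ?_⟩
    obtain ⟨g, hg⟩ := Set.mem_iInter.1 hw ⟨(F, F.filter (· ∈ Y w), H), hF, Finset.filter_subset _ _⟩
      (fun f hf => by simp [show f ∈ F from hf])
    refine ⟨g, fun h hh => ?_⟩
    obtain ⟨k, hk, hkY⟩ := hg h hh
    exact ⟨k, hk, fun f hf => by simpa [show f ∈ F from hf] using hkY f hf⟩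
  exact (hmain (insert 1 F) (Finset.insert_nonempty _ _)).mono fun g hg f hf =>
    hg f (Finset.mem_insert_of_mem hf)

/-- The shift action of a countable group on its two-colourings, indexed by `ℕ`. -/
noncomputable def shiftSystem (e : G ≃ ℕ) : GSystem G where
  X := ℕ → Bool
  ms := TopologicalSpace.metrizableSpaceMetric (ℕ → Bool)
  cs := inferInstanceAs (CompactSpace (ℕ → Bool))
  act g w n := w (e (e.symm n * g))
  act_one w := by simp
  act_mul g h w := by simp [mul_assoc]
  act_cont g := continuous_pi fun n => continuous_apply (e (e.symm n * g))

/-- A point `x` is distal iff for every piecewise syndetic recurrent point `y` of any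
`G`-system, the pair `(x,y)` is recurrent in the product system. -/
theorem distal_iff_ps_product_recurrent [Countable G] [Infinite G]
    (S : GSystem G) (x : S.X) :
    IsDistalPoint S x ↔
      ∀ T : GSystem G, ∀ y : T.X, IsPsRecurrentPoint T y →
        ∀ W ∈ nhds ((x, y) : S.X × T.X), {g : G | (S.act g x, T.act g y) ∈ W}.Infinite := by
  classical
  refine ⟨fun hx T y hy W hW => hx.recurrent_pair hy hW, fun hrec => ?_⟩
  by_contra hx
  obtain ⟨p, hp, hpp, z, hzx, hz⟩ := exists_idempotent_of_not_isDistalPoint hx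
  obtain ⟨O, hO, U, hU, hOU⟩ := Filter.disjoint_iff.1 (disjoint_nhds_nhds.2 hzx)
  obtain ⟨R, hRO, hRp, hR⟩ := exists_subset_forall_translate_mem hpp (hz hO)
  obtain ⟨Y, h1Y, hYR, hYps⟩ := exists_ps_recurrent_set hp hRp hR
  obtain ⟨e⟩ : Nonempty (G ≃ ℕ) := nonempty_equiv_of_countable
  let y : ℕ → Bool := fun n => decide (e.symm n ∈ Y)
  have hy : IsPsRecurrentPoint (shiftSystem e) y := by
    intro V hV
    replace hV : (V : Set (ℕ → Bool)) ∈ @nhds (ℕ → Bool) _ y := hV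
    obtain ⟨V', hV'V, hV', hyV'⟩ := mem_nhds_iff.1 hV
    obtain ⟨I, u, hIu, hIV⟩ := isOpen_pi_iff.1 hV' y hyV'
    refine (hYps (I.image e.symm)).mono fun g hg => hV'V (hIV fun n hn => ?_)
    have hn' := hg (e.symm n) (Finset.mem_image_of_mem _ hn)
    have : (shiftSystem e).act g y n = y n := by
      simp [shiftSystem, y, hn']
    rw [this]
    exact (hIu n hn).2
  have hV : {w : ℕ → Bool | w (e 1) = true} ∈ 𝓝 y := by
    refine IsOpen.mem_nhds ?_ (by simpa [y] using h1Y)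
    exact (isOpen_discrete {true}).preimage
      (continuous_apply (A := fun _ : ℕ => Bool) (e 1))
  refine hrec (shiftSystem e) y hy _ (prod_mem_nhds hU hV) ((Set.finite_singleton 1).subset ?_)
  rintro g ⟨hgU, hgV⟩
  have hgY : g ∈ Y := by
    have : y (e (e.symm (e 1) * g)) = true := hgV
    simpa [y] using this
  rcases hYR g hgY with h | h
  · exact h
  · exact absurd hgU (Set.disjoint_left.1 hOU (hRO h))
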